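/- arXiv:0810.0743 — 2 statements merged into one kernel-verified Lean document; each statement's English description precedes it below -/
import Mathlib

section
/- Assume k ≥ 2 and define R⁻ by R⁻_{l,l'} = min(R_{l,l'}, q_{k−1}) for all l, l' ≥ 1. Then R⁻ is symmetric and weakly exchangeable, almost surely every finite submatrix (R⁻_{l,l'})_{1≤l,l'≤n} is positive semidefinite, R⁻ satisfies the Ghirlanda–Guerra identities, and its off-diagonal value distribution is: P(R⁻_{1,2} = q_{k−1}) = 1 − m_{k−1} and P(R⁻_{1,2} = q_l) = m_{l+1} − m_l for 1 ≤ l ≤ k−2. -/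
open MeasureTheory ProbabilityTheory

noncomputable section

/-- The space of infinite real matrices. -/
abbrev Mat := ℕ → ℕ → ℝ

/-- The strictly upper-triangular part of the top-left `n × n` submatrix. -/
def subU (n : ℕ) (M : Mat) : {p : Fin n × Fin n // p.1 < p.2} → ℝ :=
  fun p => M p.1.1 p.1.2

/-- `R` is a Gram–de Finetti matrix under `P`: measurable, entries in `[-1,1]`,
symmetric, a.s. every finite submatrix positive semidefinite, and weakly
exchangeable. -/
def IsGramDeFinetti {Ω : Type*} [MeasurableSpace Ω] (P : Measure Ω) (R : Ω → Mat) : Prop :=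
  Measurable R ∧
  (∀ᵐ ω ∂P, ∀ i j, R ω i j ∈ Set.Icc (-1 : ℝ) 1) ∧
  (∀ᵐ ω ∂P, ∀ i j, R ω i j = R ω j i) ∧
  (∀ᵐ ω ∂P, ∀ (n : ℕ) (c : Fin n → ℝ),
    0 ≤ ∑ i : Fin n, ∑ j : Fin n, c i * c j * R ω i j) ∧
  (∀ (n : ℕ) (ρ : Equiv.Perm (Fin n)),
    Measure.map (fun ω => fun i j : Fin n => R ω (ρ i) (ρ j)) P
      = Measure.map (fun ω => fun i j : Fin n => R ω i j) P)

/-- `R` satisfies the Ghirlanda–Guerra identities under `P`. -/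
def SatisfiesGGI {Ω : Type*} [MeasurableSpace Ω] (P : Measure Ω) (R : Ω → Mat) : Prop :=
  ∀ (n : ℕ), 2 ≤ n → ∀ (f : ({p : Fin n × Fin n // p.1 < p.2} → ℝ) → ℝ),
    Measurable f → (∃ C, ∀ x, |f x| ≤ C) →
    ∀ (ψ : ℝ → ℝ), Measurable ψ → (∃ C, ∀ x, |ψ x| ≤ C) →
    ∫ ω, f (subU n (R ω)) * ψ (R ω 0 n) ∂P
      = (1 / n) * (∫ ω, f (subU n (R ω)) ∂P) * (∫ ω, ψ (R ω 0 1) ∂P)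
        + (1 / n) * ∑ l ∈ Finset.Ico 1 n, ∫ ω, f (subU n (R ω)) * ψ (R ω 0 l) ∂P

/-- The finite-value condition: ones on the diagonal, and the off-diagonal entries
take values `q 1 < ⋯ < q k` with probabilities `m (l+1) - m l`, where
`0 ≤ q 1`, `q k ≤ 1`, `0 = m 1 < ⋯ < m k < m (k+1) = 1`. -/
def FiniteValueCondition {Ω : Type*} [MeasurableSpace Ω] (P : Measure Ω) (R : Ω → Mat)
    (k : ℕ) (q m : ℕ → ℝ) : Prop :=
  (∀ᵐ ω ∂P, ∀ l, R ω l l = 1) ∧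
  (∀ l, 1 ≤ l → l < k → q l < q (l + 1)) ∧ (0 ≤ q 1) ∧ (q k ≤ 1) ∧
  (m 1 = 0) ∧ (m (k + 1) = 1) ∧ (∀ l, 1 ≤ l → l ≤ k → m l < m (l + 1)) ∧
  (∀ l, 1 ≤ l → l ≤ k →
    P {ω | R ω 0 1 = q l} = ENNReal.ofReal (m (l + 1) - m l))

/-- The simultaneous relabelling of rows and columns. -/
def relabel (σ : ℕ → ℕ) (X : Mat) : Mat := fun i j => X (σ i) (σ j)

lemma measurable_relabel (σ : ℕ → ℕ) : Measurable (relabel σ) := by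
  unfold relabel; fun_prop

lemma map_submatrix_eq_of_injective {Ω : Type*} [MeasurableSpace Ω] {P : Measure Ω}
    {R : Ω → Mat} (hR : Measurable R)
    (hexch : ∀ (n : ℕ) (ρ : Equiv.Perm (Fin n)),
      Measure.map (fun ω => fun i j : Fin n => R ω (ρ i) (ρ j)) P
        = Measure.map (fun ω => fun i j : Fin n => R ω i j) P)
    (n : ℕ) (σ : Fin n → ℕ) (hσ : Function.Injective σ) :
    P.map (fun ω => fun i j : Fin n => R ω (σ i) (σ j))
      = P.map (fun ω => fun i j : Fin n => R ω i j) := by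
  obtain ⟨N, hN⟩ : ∃ N, n ≤ N ∧ ∀ i, σ i < N := by
    refine ⟨n + ∑ i, (σ i + 1), by omega, fun i => ?_⟩
    have := Finset.single_le_sum (f := fun i => σ i + 1) (fun _ _ => Nat.zero_le _)
      (Finset.mem_univ i)
    omega
  obtain ⟨ρ, hρ⟩ := Equiv.Perm.exists_extending_pair (Fin.castLE hN.1)
    (fun i => (⟨σ i, hN.2 i⟩ : Fin N)) (Fin.castLE_injective _)
    (fun a b h => hσ (by simpa using h))
  have hg : Measurable (fun (X : Fin N → Fin N → ℝ) (i j : Fin n) =>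
      X (Fin.castLE hN.1 i) (Fin.castLE hN.1 j)) := by fun_prop
  have h := congrArg (Measure.map (fun (X : Fin N → Fin N → ℝ) (i j : Fin n) =>
      X (Fin.castLE hN.1 i) (Fin.castLE hN.1 j))) (hexch N ρ)
  rw [Measure.map_map hg (by fun_prop), Measure.map_map hg (by fun_prop)] at h
  simpa [Function.comp_def, hρ] using h

lemma map_relabel_eq {Ω : Type*} [MeasurableSpace Ω] {P : Measure Ω} [IsProbabilityMeasure P]
    {R : Ω → Mat} (hR : Measurable R)
    (hexch : ∀ (n : ℕ) (ρ : Equiv.Perm (Fin n)),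
      Measure.map (fun ω => fun i j : Fin n => R ω (ρ i) (ρ j)) P
        = Measure.map (fun ω => fun i j : Fin n => R ω i j) P)
    (σ : ℕ → ℕ) (hσ : Function.Injective σ) :
    (P.map R).map (relabel σ) = P.map R := by
  let e := MeasurableEquiv.curry ℕ ℕ ℝ
  have key : (((P.map R).map (relabel σ)).map e.symm) = (P.map R).map e.symm := by
    have : IsProbabilityMeasure (P.map R) := Measure.isProbabilityMeasure_map hR.aemeasurable
    have : IsProbabilityMeasure ((P.map R).map e.symm) :=
      Measure.isProbabilityMeasure_map e.symm.measurable.aemeasurable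
    refine IsProjectiveLimit.unique (P := fun I => ((P.map R).map e.symm).map I.restrict)
      (fun I => ?_) (fun I => rfl)
    obtain ⟨N, hN⟩ : ∃ N, ∀ p ∈ I, p.1 < N ∧ p.2 < N := by
      refine ⟨∑ p ∈ I, (p.1 + p.2 + 1), fun p hp => ?_⟩
      have := Finset.single_le_sum (f := fun p : ℕ × ℕ => p.1 + p.2 + 1)
        (fun _ _ => Nat.zero_le _) hp
      omega
    let g : (Fin N → Fin N → ℝ) → (I → ℝ) := fun X p =>
      X ⟨p.1.1, (hN p.1 p.2).1⟩ ⟨p.1.2, (hN p.1 p.2).2⟩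
    have hg : Measurable g := by unfold g; fun_prop
    have h := congrArg (Measure.map g)
      (map_submatrix_eq_of_injective hR hexch N (fun i => σ i)
        (fun a b h => Fin.ext (hσ h)))
    rw [Measure.map_map hg (by fun_prop), Measure.map_map hg (by fun_prop)] at h
    beta_reduce
    rw [Measure.map_map e.symm.measurable (measurable_relabel σ), Measure.map_map
      (Finset.measurable_restrict I) (e.symm.measurable.comp (measurable_relabel σ)),
      Measure.map_map (Finset.measurable_restrict I) e.symm.measurable,
      Measure.map_map ((Finset.measurable_restrict I).comp
        (e.symm.measurable.comp (measurable_relabel σ))) hR,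
      Measure.map_map ((Finset.measurable_restrict I).comp e.symm.measurable) hR]
    exact h
  have h2 := congrArg (Measure.map e) key
  rwa [Measure.map_map e.measurable e.symm.measurable,
    Measure.map_map e.measurable e.symm.measurable, e.self_comp_symm, Measure.map_id,
    Measure.map_id] at h2

lemma satisfiesGGI_map {Ω : Type*} [MeasurableSpace Ω] {P : Measure Ω} {R : Ω → Mat}
    (hR : Measurable R) (h : SatisfiesGGI P R) : SatisfiesGGI (P.map R) id := by
  intro n hn f hf hfb ψ hψ hψb
  have hs : Measurable (fun X : Mat => subU n X) := by unfold subU; fun_prop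
  have e (l : ℕ) : ∫ X, f (subU n (id X)) * ψ (id X 0 l) ∂(P.map R)
      = ∫ ω, f (subU n (R ω)) * ψ (R ω 0 l) ∂P := by
    refine integral_map hR.aemeasurable (Measurable.aestronglyMeasurable ?_)
    simp only [id]
    exact (hf.comp hs).mul (hψ.comp (by fun_prop))
  have e1 : ∫ X, f (subU n (id X)) ∂(P.map R) = ∫ ω, f (subU n (R ω)) ∂P :=
    integral_map hR.aemeasurable (hf.comp hs).aestronglyMeasurable
  have e2 : ∫ X, ψ (id X 0 1) ∂(P.map R) = ∫ ω, ψ (R ω 0 1) ∂P := by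
    refine integral_map hR.aemeasurable (Measurable.aestronglyMeasurable ?_)
    exact hψ.comp (by fun_prop)
  simp only [e, e1, e2]
  exact h n hn f hf hfb ψ hψ hψb

/-- The symmetric matrix with a prescribed strictly upper-triangular top-left part. -/
def symFill (N : ℕ) (x : {p : Fin N × Fin N // p.1 < p.2} → ℝ) : Mat := fun a b =>
  if h : a < b ∧ b < N then x ⟨(⟨a, h.1.trans h.2⟩, ⟨b, h.2⟩), h.1⟩
  else if h : b < a ∧ a < N then x ⟨(⟨b, h.1.trans h.2⟩, ⟨a, h.2⟩), h.1⟩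
  else 0

lemma measurable_symFill (N : ℕ) : Measurable (symFill N) := by
  refine measurable_pi_iff.2 fun a => measurable_pi_iff.2 fun b => ?_
  unfold symFill
  split_ifs <;> fun_prop

lemma symFill_subU {N : ℕ} {X : Mat} (hX : ∀ i j, X i j = X j i) {a b : ℕ} (ha : a < N)
    (hb : b < N) (hab : a ≠ b) : symFill N (subU N X) a b = X a b := by
  unfold symFill subU
  rcases lt_or_gt_of_ne hab with h | h
  · simp [h, hb]
  · simp [h, ha, h.not_gt, hX a b]

/-- Under the Ghirlanda–Guerra identities, if an event `U` determined by the first `N` replicas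
forces the overlaps of replica `0` to be at most `t`, then conditionally on `U` a new replica
has overlap at most `t` with replica `0` with probability at least `(N - 1) / N`. -/
lemma ggi_measure_le {L : Measure Mat} [IsProbabilityMeasure L]
    (hsym : ∀ᵐ X ∂L, ∀ i j, X i j = X j i) (hG : SatisfiesGGI L id) (t : ℝ) {N : ℕ} (hN : 2 ≤ N)
    {U : Set Mat} (hU : MeasurableSet U)
    (hloc : ∀ X Y : Mat, (∀ a b, a < N → b < N → a ≠ b → X a b = Y a b) → (X ∈ U ↔ Y ∈ U))
    (hle : ∀ X ∈ U, ∀ l, 1 ≤ l → l < N → X 0 l ≤ t) :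
    (N - 1) * L.real U ≤ N * L.real (U ∩ {X | X 0 N ≤ t}) := by
  classical
  have hbd {α : Type} (s : Set α) : ∃ C : ℝ, ∀ x, |s.indicator (fun _ => (1 : ℝ)) x| ≤ C :=
    ⟨1, fun x => by by_cases h : x ∈ s <;> simp [h]⟩
  have h := hG N hN ((symFill N ⁻¹' U).indicator (fun _ => (1 : ℝ)))
    (measurable_const.indicator (measurable_symFill N hU)) (hbd _)
    ((Set.Iic t).indicator (fun _ => (1 : ℝ)))
    (measurable_const.indicator measurableSet_Iic) (hbd _)
  have hmem : ∀ᵐ X ∂L, (symFill N (subU N X) ∈ U ↔ X ∈ U) := by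
    filter_upwards [hsym] with X hX
    exact hloc _ _ fun a b ha hb hab => symFill_subU hX ha hb hab
  have hm (l : ℕ) : MeasurableSet {X : Mat | X 0 l ≤ t} :=
    measurableSet_le (by fun_prop) measurable_const
  have e (l : ℕ) : ∫ X, (symFill N ⁻¹' U).indicator (fun _ => (1 : ℝ)) (subU N (id X))
      * (Set.Iic t).indicator (fun _ => (1 : ℝ)) (id X 0 l) ∂L
      = L.real (U ∩ {X | X 0 l ≤ t}) := by
    rw [← integral_indicator_one (hU.inter (hm l))]
    refine integral_congr_ae ?_
    filter_upwards [hmem] with X hX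
    by_cases h1 : X ∈ U <;> by_cases h2 : X 0 l ≤ t <;> simp [Set.indicator, hX, h1, h2]
  have e' : ∀ l ∈ Finset.Ico 1 N, L.real (U ∩ {X | X 0 l ≤ t}) = L.real U := by
    intro l hl
    rw [Finset.mem_Ico] at hl
    congr 1
    exact Set.inter_eq_left.2 fun X hX => hle X hX l hl.1 hl.2
  simp only [e] at h
  rw [Finset.sum_congr rfl e', Finset.sum_const, Nat.card_Ico, nsmul_eq_mul,
    Nat.cast_sub (by omega), Nat.cast_one] at h
  have hN0 : (0 : ℝ) < N := by positivity
  have hn1 : 0 ≤ ∫ X, (symFill N ⁻¹' U).indicator (fun _ => (1 : ℝ)) (subU N (id X)) ∂L :=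
    integral_nonneg fun X => Set.indicator_nonneg (fun _ _ => zero_le_one) _
  have hn2 : 0 ≤ ∫ X, (Set.Iic t).indicator (fun _ => (1 : ℝ)) (id X 0 1) ∂L :=
    integral_nonneg fun X => Set.indicator_nonneg (fun _ _ => zero_le_one) _
  rw [h]
  have := mul_nonneg hn1 hn2
  field_simp
  linarith

/-- The first `n` replicas, replica `a` having type `τ a`, have pairwise overlaps at most `t`,
and replicas of different types have the overlap that `A` prescribes for these types. -/
def IsTyped (A : Mat) (t : ℝ) (τ : ℕ → ℕ) (n : ℕ) (X : Mat) : Prop :=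
  ∀ a < n, ∀ b < n, a ≠ b → X a b ≤ t ∧ (τ a ≠ τ b → X a b = A (τ a) (τ b))

lemma measurableSet_isTyped (A : Mat) (t : ℝ) (τ : ℕ → ℕ) (n : ℕ) :
    MeasurableSet {X | IsTyped A t τ n X} := by
  have h1 (a b : ℕ) : MeasurableSet {X : Mat | X a b ≤ t} :=
    measurableSet_le (by fun_prop) measurable_const
  have h2 (a b : ℕ) : MeasurableSet {X : Mat | X a b = A (τ a) (τ b)} :=
    measurableSet_eq_fun (by fun_prop) measurable_const
  simp only [IsTyped, Set.ofPred_forall]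
  refine MeasurableSet.iInter fun a => MeasurableSet.iInter fun _ => MeasurableSet.iInter fun b =>
    MeasurableSet.iInter fun _ => MeasurableSet.iInter fun _ => ?_
  by_cases hab : τ a = τ b
  · simpa [hab] using h1 a b
  · simpa [hab, Set.ofPred_and] using (h1 a b).inter (h2 a b)

lemma measure_preimage_relabel {L : Measure Mat}
    (hexch : ∀ σ : ℕ → ℕ, Function.Injective σ → L.map (relabel σ) = L) (ρ : Equiv.Perm ℕ)
    {U : Set Mat} (hU : MeasurableSet U) : L (relabel ρ ⁻¹' U) = L U := by
  rw [← Measure.map_apply (measurable_relabel ρ) hU, hexch ρ ρ.injective]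

/-- Replica `x` may take the place of replica `0` in the typed configuration. -/
def substSet (A : Mat) (t : ℝ) (τ : ℕ → ℕ) (n x : ℕ) : Set Mat :=
  {X | IsTyped A t τ n (relabel (fun a => if a = 0 then x else a) X)}

lemma IsTyped.congr {A : Mat} {t : ℝ} {τ : ℕ → ℕ} {n : ℕ} {X Y : Mat}
    (h : IsTyped A t τ n X) (hXY : ∀ a < n, ∀ b < n, a ≠ b → X a b = Y a b) :
    IsTyped A t τ n Y := fun a ha b hb hab => hXY a ha b hb hab ▸ h a ha b hb hab

lemma measure_isTyped_succ_of_zero {L : Measure Mat} [IsProbabilityMeasure L]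
    (hsym : ∀ᵐ X ∂L, ∀ i j, X i j = X j i) (hG : SatisfiesGGI L id)
    (hexch : ∀ σ : ℕ → ℕ, Function.Injective σ → L.map (relabel σ) = L)
    (A : Mat) (t : ℝ) (τ : ℕ → ℕ) {n : ℕ} (hn : 2 ≤ n) (hτ : τ n = τ 0)
    (h : L {X | IsTyped A t τ n X} ≠ 0) : L {X | IsTyped A t τ (n + 1) X} ≠ 0 := by
  intro h0
  set T : Set Mat := {X | IsTyped A t τ n X} with hT
  have hTm : MeasurableSet T := measurableSet_isTyped A t τ n
  let S : ℕ → Set Mat := substSet A t τ n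
  have hSm (x : ℕ) : MeasurableSet (S x) := measurable_relabel _ hTm
  -- almost surely no new replica with overlap at most `t` can replace replica `0`
  have hno (i : ℕ) : ∀ᵐ X ∂L, X ∈ T → X 0 (n + i) ≤ t → X ∉ S (n + i) := by
    have h1 : ∀ᵐ X ∂L, ¬ IsTyped A t τ (n + 1) (relabel (Equiv.swap n (n + i)) X) := by
      rw [ae_iff]
      simp only [not_not]
      exact (measure_preimage_relabel hexch (Equiv.swap n (n + i))
        (measurableSet_isTyped A t τ (n + 1))).trans h0
    filter_upwards [h1, hsym] with X hX hs hXT hXt hXS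
    refine hX fun a ha b hb hab => ?_
    have hlt (c : ℕ) (hc : c < n) : Equiv.swap n (n + i) c = c :=
      Equiv.swap_apply_of_ne_of_ne (by omega) (by omega)
    have key (c : ℕ) (hc : c < n) :
        X c (n + i) ≤ t ∧ (τ c ≠ τ n → X c (n + i) = A (τ c) (τ n)) ∧
          (τ n ≠ τ c → X c (n + i) = A (τ n) (τ c)) := by
      rcases Nat.eq_zero_or_pos c with rfl | hc0
      · exact ⟨hXt, fun h => absurd hτ.symm h, fun h => absurd hτ h⟩
      · have h1 := hXS c hc 0 (by omega) hc0.ne'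
        have h2 := hXS 0 (by omega) c hc hc0.ne
        simp only [relabel, hc0.ne', if_true, if_false, ← hτ] at h1 h2
        exact ⟨h1.1, h1.2, fun h => (hs _ _).trans (h2.2 h)⟩
    rcases Nat.lt_succ_iff_lt_or_eq.1 ha with ha | rfl <;>
      rcases Nat.lt_succ_iff_lt_or_eq.1 hb with hb | rfl
    · simp only [relabel, hlt a ha, hlt b hb]
      exact hXT a ha b hb hab
    · simp only [relabel, hlt a ha, Equiv.swap_apply_left]
      exact ⟨(key a ha).1, (key a ha).2.1⟩
    · simp only [relabel, hlt b hb, Equiv.swap_apply_left]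
      rw [hs]
      exact ⟨(key b hb).1, (key b hb).2.2⟩
    · exact absurd rfl hab
  let U : ℕ → Set Mat := fun j => T ∩ {X | ∀ l, 1 ≤ l → l < n + j → X 0 l ≤ t}
  have hUm (j : ℕ) : MeasurableSet (U j) := by
    refine hTm.inter ?_
    simp only [Set.ofPred_forall]
    exact MeasurableSet.iInter fun l => MeasurableSet.iInter fun _ => MeasurableSet.iInter fun _ =>
      measurableSet_le (by fun_prop) measurable_const
  have hU0 : U 0 = T := Set.inter_eq_left.2 fun X hX l hl hln =>
    (hX 0 (by omega) l hln (by omega)).1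
  have hUstep (j : ℕ) : ((n + j : ℕ) - 1 : ℝ) * L.real (U j)
      ≤ (n + j : ℕ) * L.real (U (j + 1)) := by
    have e : U (j + 1) = U j ∩ {X | X 0 (n + j) ≤ t} := by
      ext X
      simp only [U, Set.mem_inter_iff, Set.mem_ofPred_eq, and_assoc]
      refine and_congr_right fun _ => ⟨fun hX => ⟨fun l h1 h2 => hX l h1 (by omega),
        hX _ (by omega) (by omega)⟩, fun hX l h1 h2 => ?_⟩
      rcases (show l < n + j ∨ l = n + j by omega) with h3 | rfl
      · exact hX.1 l h1 h3
      · exact hX.2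
    rw [e]
    refine ggi_measure_le hsym hG t (by omega) (hUm j) ?_ fun X hX => hX.2
    have main (X Y : Mat) (hXY : ∀ a b, a < n + j → b < n + j → a ≠ b → X a b = Y a b)
        (hX : X ∈ U j) : Y ∈ U j :=
      ⟨IsTyped.congr hX.1 fun a ha b hb hab => hXY a b (by omega) (by omega) hab,
        fun l h1 h2 => hXY 0 l (by omega) h2 (by omega) ▸ hX.2 l h1 h2⟩
    exact fun X Y hXY => ⟨main X Y hXY, main Y X fun a b ha hb hab => (hXY a b ha hb hab).symm⟩
  have hUlow (j : ℕ) : ((n : ℝ) - 1) * L.real T ≤ ((n + j : ℕ) - 1 : ℝ) * L.real (U j) := by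
    induction j with
    | zero => simp [hU0]
    | succ j ih => exact ih.trans ((hUstep j).trans_eq (by push_cast; ring))
  let D : ℕ → Set Mat := fun j => S (n + j) \ ⋃ i ∈ Finset.range j, S (n + i)
  have hDm (j : ℕ) : MeasurableSet (D j) :=
    (hSm _).diff (Finset.measurableSet_biUnion _ fun i _ => hSm _)
  have hDdisj : Pairwise (Function.onFun Disjoint D) := by
    have main (i j : ℕ) (hij : i < j) : Disjoint (D i) (D j) :=
      Set.disjoint_left.2 fun X hi hj =>
        hj.2 (Set.mem_biUnion (Finset.mem_coe.2 (Finset.mem_range.2 hij)) hi.1)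
    intro i j hij
    rcases lt_or_gt_of_ne hij with h | h
    · exact main i j h
    · exact (main j i h).symm
  have hUD (j : ℕ) : L (U j) ≤ L (D j) := by
    rw [← measure_preimage_relabel hexch (Equiv.swap 0 (n + j)) (hDm j)]
    have hcomp (i a : ℕ) (ha : a < n) (hij : i ≤ j) :
        Equiv.swap 0 (n + j) (if a = 0 then n + i else a)
          = if a = 0 then (if i = j then 0 else n + i) else a := by
      split_ifs with h1 h2
      · subst h2; simp
      · exact Equiv.swap_apply_of_ne_of_ne (by omega) (by omega)
      · exact Equiv.swap_apply_of_ne_of_ne (by omega) (by omega)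
    refine measure_mono_ae ?_
    filter_upwards [ae_all_iff.2 hno] with X hX (hXU : X ∈ U j)
    refine ⟨?_, ?_⟩
    · refine IsTyped.congr hXU.1 fun a ha b hb hab => ?_
      simp only [relabel, hcomp j a ha le_rfl, hcomp j b hb le_rfl, if_true]
      split_ifs <;> simp_all
    · simp only [Set.mem_iUnion, Finset.mem_range, not_exists]
      intro i hij hi
      refine hX i hXU.1 (hXU.2 (n + i) (by omega) (by omega))
        (IsTyped.congr hi fun a ha b hb hab => ?_)
      simp only [relabel, hcomp i a ha hij.le, hcomp i b hb hij.le, hij.ne, if_false]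
  have hsum : Summable fun j => L.real (D j) := by
    refine ENNReal.summable_toReal (ne_top_of_le_ne_top (measure_ne_top L Set.univ) ?_)
    exact tsum_measure_le_measure_univ (fun j => (hDm j).nullMeasurableSet)
      fun i j hij => (hDdisj hij).aedisjoint
  have hc : 0 < ((n : ℝ) - 1) * L.real T := by
    have : (2 : ℝ) ≤ n := by exact_mod_cast hn
    have : 0 < L.real T := ENNReal.toReal_pos h (measure_ne_top _ _)
    nlinarith
  have hlow (j : ℕ) : ((n : ℝ) - 1) * L.real T * (1 / ((j + n : ℕ) : ℝ)) ≤ L.real (D j) := by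
    have h1 : L.real (U j) ≤ L.real (D j) := ENNReal.toReal_mono (measure_ne_top _ _) (hUD j)
    have h2 := hUlow j
    have h3 : (0 : ℝ) < ((j + n : ℕ) : ℝ) := by
      exact_mod_cast (by omega : 0 < j + n)
    rw [mul_one_div, div_le_iff₀ h3, add_comm j n]
    have := measureReal_nonneg (μ := L) (s := U j)
    rw [add_comm j n] at h3
    nlinarith
  have hsum2 := Summable.of_nonneg_of_le (fun j => by positivity) hlow hsum
  rw [summable_mul_left_iff hc.ne'] at hsum2
  exact Real.not_summable_one_div_natCast
    ((summable_nat_add_iff (f := fun j : ℕ => 1 / (j : ℝ)) n).1 hsum2)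

lemma measure_isTyped_succ {L : Measure Mat} [IsProbabilityMeasure L]
    (hsym : ∀ᵐ X ∂L, ∀ i j, X i j = X j i) (hG : SatisfiesGGI L id)
    (hexch : ∀ σ : ℕ → ℕ, Function.Injective σ → L.map (relabel σ) = L)
    (A : Mat) (t : ℝ) (τ : ℕ → ℕ) {n a : ℕ} (hn : 2 ≤ n) (ha : a < n) (hτ : τ n = τ a)
    (h : L {X | IsTyped A t τ n X} ≠ 0) : L {X | IsTyped A t τ (n + 1) X} ≠ 0 := by
  have key (N : ℕ) (hN : n ≤ N) :
      L {X | IsTyped A t (τ ∘ Equiv.swap 0 a) N X} = L {X | IsTyped A t τ N X} := by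
    rw [← measure_preimage_relabel hexch (Equiv.swap 0 a) (measurableSet_isTyped A t τ N)]
    have hlt (b : ℕ) (hb : b < N) : Equiv.swap 0 a b < N := by
      rw [Equiv.swap_apply_def]
      split_ifs <;> omega
    congr 1
    ext X
    refine ⟨fun hX b hb c hc hbc => ?_, fun hX b hb c hc hbc => ?_⟩
    · simpa [relabel] using hX _ (hlt b hb) _ (hlt c hc) ((Equiv.swap 0 a).injective.ne hbc)
    · simpa [relabel] using hX _ (hlt b hb) _ (hlt c hc) ((Equiv.swap 0 a).injective.ne hbc)
  rw [← key (n + 1) (by omega)]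
  refine measure_isTyped_succ_of_zero hsym hG hexch A t _ hn ?_ (by rwa [key n le_rfl])
  simp [Equiv.swap_apply_of_ne_of_ne (show n ≠ 0 by omega) ha.ne', hτ]

/-- If the configuration `A` of `n` replicas has positive probability and its off-diagonal overlaps
are at most `t`, then `A` with diagonal entries replaced by `t` is positive semidefinite. -/
lemma quadratic_nonneg_of_attained {L : Measure Mat} [IsProbabilityMeasure L]
    (hsym : ∀ᵐ X ∂L, ∀ i j, X i j = X j i) (hG : SatisfiesGGI L id)
    (hexch : ∀ σ : ℕ → ℕ, Function.Injective σ → L.map (relabel σ) = L)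
    (hpsd : ∀ᵐ X ∂L, ∀ (n : ℕ) (c : Fin n → ℝ), 0 ≤ ∑ i : Fin n, ∑ j : Fin n, c i * c j * X i j)
    (hdiag : ∀ᵐ X ∂L, ∀ i, X i i = 1)
    {n : ℕ} (hn : 2 ≤ n) (A : Fin n → Fin n → ℝ) (t : ℝ) (hA : ∀ i j, i ≠ j → A i j ≤ t)
    (hpos : L {X | ∀ i j : Fin n, i ≠ j → X i j = A i j} ≠ 0) (c : Fin n → ℝ) :
    0 ≤ ∑ i, ∑ j, c i * c j * (if i = j then t else A i j) := by
  set Q := ∑ i, ∑ j, c i * c j * (if i = j then t else A i j) with hQ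
  let A' : Mat := fun a b => if h : a < n ∧ b < n then A ⟨a, h.1⟩ ⟨b, h.2⟩ else 0
  let τ : ℕ → ℕ := fun a => a % n
  have htyped (N : ℕ) : L {X | IsTyped A' t τ (n + N) X} ≠ 0 := by
    induction N with
    | zero =>
      refine fun h0 => hpos (measure_mono_null ?_ h0)
      intro X hX a ha b hb hab
      have h1 := hX ⟨a, ha⟩ ⟨b, hb⟩ (by simpa using hab)
      simp only at h1
      rw [h1]
      refine ⟨hA _ _ (by simpa using hab), fun _ => ?_⟩
      simp only [add_zero] at ha hb
      simp [A', τ, Nat.mod_eq_of_lt ha, Nat.mod_eq_of_lt hb, ha, hb]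
    | succ N ih =>
      exact measure_isTyped_succ hsym hG hexch A' t τ (n := n + N) (a := N) (by omega) (by omega)
        (by simp [τ]) ih
  have hblow (M : ℕ) : 0 ≤ (M + 1 : ℝ) * ((M + 1) * Q + (1 - t) * ∑ i, c i * c i) := by
    obtain ⟨X, hX, hXpsd, hXdiag⟩ : ∃ X, IsTyped A' t τ ((M + 1) * n) X ∧
        (∀ (n : ℕ) (c : Fin n → ℝ), 0 ≤ ∑ i : Fin n, ∑ j : Fin n, c i * c j * X i j) ∧
        ∀ i, X i i = 1 := by
      have h1 := htyped (M * n)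
      rw [show n + M * n = (M + 1) * n by ring] at h1
      exact (((frequently_ae_iff.2 h1).and_eventually (hpsd.and hdiag))).exists
    have h0 := hXpsd ((M + 1) * n) (fun a => c (finProdFinEquiv.symm a).2)
    rw [← finProdFinEquiv.sum_comp] at h0
    simp only [← finProdFinEquiv.sum_comp (fun b => _ * _ * X _ (Fin.val b)),
      Equiv.symm_apply_apply] at h0
    have hterm (x y : Fin (M + 1) × Fin n) :
        c x.2 * c y.2 * X (finProdFinEquiv x) (finProdFinEquiv y)
          ≤ c x.2 * c y.2 * (if x.2 = y.2 then t else A x.2 y.2)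
            + if x = y then (1 - t) * (c x.2 * c x.2) else 0 := by
      have hmod (z : Fin (M + 1) × Fin n) : τ (finProdFinEquiv z) = z.2 := by
        simp [τ, finProdFinEquiv, Nat.mod_eq_of_lt z.2.2]
      rcases eq_or_ne x y with rfl | hxy
      · simp only [hXdiag, if_true]
        linarith
      · have h1 := hX _ (finProdFinEquiv x).2 _ (finProdFinEquiv y).2
          (fun h => hxy (finProdFinEquiv.injective (Fin.ext h)))
        rw [hmod, hmod] at h1
        simp only [hxy, if_false, add_zero]
        by_cases h2 : x.2 = y.2
        · simp only [h2, if_true]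
          exact mul_le_mul_of_nonneg_left h1.1 (mul_self_nonneg _)
        · simp only [h2, if_false]
          rw [h1.2 (fun h => h2 (Fin.ext h))]
          simp [A']
    refine (h0.trans (Finset.sum_le_sum fun x _ => Finset.sum_le_sum fun y _ =>
      hterm x y)).trans_eq ?_
    simp only [Finset.sum_add_distrib, Fintype.sum_prod_type, Finset.sum_ite_eq, Finset.mem_univ,
      if_true, Finset.sum_const, Finset.card_univ, Fintype.card_fin, nsmul_eq_mul]
    rw [hQ]
    push_cast
    simp only [← Finset.mul_sum]
    ring
  by_contra hneg
  obtain ⟨M, hM⟩ := exists_nat_gt (((1 - t) * ∑ i, c i * c i) / (-Q))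
  rw [div_lt_iff₀ (by linarith)] at hM
  have := nonneg_of_mul_nonneg_right (hblow M) (by positivity)
  nlinarith

lemma ae_quadratic_nonneg {L : Measure Mat} [IsProbabilityMeasure L]
    (hsym : ∀ᵐ X ∂L, ∀ i j, X i j = X j i) (hG : SatisfiesGGI L id)
    (hexch : ∀ σ : ℕ → ℕ, Function.Injective σ → L.map (relabel σ) = L)
    (hpsd : ∀ᵐ X ∂L, ∀ (n : ℕ) (c : Fin n → ℝ), 0 ≤ ∑ i : Fin n, ∑ j : Fin n, c i * c j * X i j)
    (hdiag : ∀ᵐ X ∂L, ∀ i, X i i = 1)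
    {V : Set ℝ} (hV : V.Countable) (hval : ∀ᵐ X ∂L, ∀ i j, i ≠ j → X i j ∈ V) :
    ∀ᵐ X ∂L, ∀ (s : Finset ℕ) (t : ℝ), 2 ≤ s.card → (∀ i ∈ s, ∀ j ∈ s, i ≠ j → X i j ≤ t) →
      ∀ c : ℕ → ℝ, 0 ≤ ∑ i ∈ s, ∑ j ∈ s, c i * c j * (if i = j then t else X i j) := by
  have := hV.to_subtype
  have h1 : ∀ᵐ X ∂L, ∀ (n : ℕ) (σ : Fin n → ℕ) (b : Fin n → Fin n → Option V),
      Function.Injective σ → (∀ i j, i ≠ j → some (X (σ i) (σ j)) = (b i j).map Subtype.val) →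
      L {X | ∀ i j : Fin n, i ≠ j → some (X i j) = (b i j).map Subtype.val} ≠ 0 := by
    simp only [ae_all_iff]
    intro n σ b hσ
    by_cases h0 : L {X | ∀ i j : Fin n, i ≠ j → some (X i j) = (b i j).map Subtype.val} = 0
    · obtain ⟨ρ, hρ⟩ := Equiv.Perm.exists_extending_pair (Fin.val : Fin n → ℕ) σ
        Fin.val_injective hσ
      have hm : MeasurableSet
          {X : Mat | ∀ i j : Fin n, i ≠ j → some (X i j) = (b i j).map Subtype.val} := by
        simp only [Set.ofPred_forall]
        refine MeasurableSet.iInter fun i => MeasurableSet.iInter fun j =>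
          MeasurableSet.iInter fun _ => ?_
        rcases b i j with _ | v
        · simp
        · simpa using measurableSet_eq_fun
            (show Measurable fun X : Mat => X i j by fun_prop) measurable_const
      have h2 := measure_preimage_relabel hexch ρ hm
      rw [h0] at h2
      filter_upwards [measure_eq_zero_iff_ae_notMem.1 h2] with X hX hX'
      refine absurd ?_ hX
      simpa [relabel, hρ] using hX'
    · exact Filter.Eventually.of_forall fun _ _ => h0
  filter_upwards [h1, hval] with X hX hXV s t hs hst c
  let e := s.equivFin.symm
  let σ : Fin s.card → ℕ := fun i => e i
  have hσ : Function.Injective σ := Subtype.val_injective.comp e.injective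
  have hsum (f : ℕ → ℝ) : ∑ i ∈ s, f i = ∑ i, f (σ i) := by
    rw [← Finset.sum_coe_sort, ← e.sum_comp]
  have hb : ∀ i j : Fin s.card, ∃ v : Option V,
      i ≠ j → some (X (σ i) (σ j)) = v.map Subtype.val := by
    intro i j
    by_cases hij : i = j
    · exact ⟨none, fun h => absurd hij h⟩
    · exact ⟨some ⟨_, hXV _ _ (hσ.ne hij)⟩, fun _ => rfl⟩
  choose b hb using hb
  have h2 := hX _ σ b hσ hb
  have h3 : {Y : Mat | ∀ i j : Fin s.card, i ≠ j → some (Y i j) = (b i j).map Subtype.val}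
      = {Y | ∀ i j : Fin s.card, i ≠ j → Y i j = X (σ i) (σ j)} := by
    ext Y
    refine forall_congr' fun i => forall_congr' fun j => forall_congr' fun hij => ?_
    rw [← hb i j hij, Option.some_inj]
  rw [h3] at h2
  have h4 := quadratic_nonneg_of_attained hsym hG hexch hpsd hdiag hs
    (fun i j => X (σ i) (σ j)) t (fun i j hij => hst _ (e i).2 _ (e j).2 (hσ.ne hij)) h2
    (fun i => c (σ i))
  simp only [hsum, hσ.eq_iff]
  exact h4

lemma sum_mul_eq_sum_erase {s : Finset ℕ} {a b : ℕ} (ha : a ∈ s) (hb : b ∈ s) (hab : a ≠ b)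
    (c f : ℕ → ℝ) (hf : f a = f b) :
    ∑ i ∈ s, c i * f i = ∑ i ∈ s.erase b, Function.update c a (c a + c b) i * f i := by
  have ha' : a ∈ s.erase b := Finset.mem_erase.2 ⟨hab, ha⟩
  rw [← Finset.add_sum_erase s _ hb, ← Finset.add_sum_erase _ _ ha',
    ← Finset.add_sum_erase _ _ ha', Function.update_self, Finset.sum_congr rfl
      (g := fun i => Function.update c a (c a + c b) i * f i)
      (fun i hi => by rw [Function.update_of_ne (Finset.ne_of_mem_erase hi)]), hf]
  ring

/-- Merging the classes of the top value `r` and lowering the diagonal to `p` shows that the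
truncation of `M` at the second largest value `p` is positive semidefinite. -/
lemma truncation_quadratic_nonneg {M : Mat} {p r : ℝ} (hsym : ∀ i j, M i j = M j i)
    (hdiag : ∀ i, M i i = 1) (hp0 : 0 ≤ p) (hpr : p < r) (hr1 : r ≤ 1)
    (hval : ∀ i j, i ≠ j → M i j ≤ p ∨ M i j = r)
    (hquad : ∀ (s : Finset ℕ) (t : ℝ), 2 ≤ s.card → (∀ i ∈ s, ∀ j ∈ s, i ≠ j → M i j ≤ t) →
      ∀ c : ℕ → ℝ, 0 ≤ ∑ i ∈ s, ∑ j ∈ s, c i * c j * (if i = j then t else M i j))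
    (s : Finset ℕ) (c : ℕ → ℝ) : 0 ≤ ∑ i ∈ s, ∑ j ∈ s, c i * c j * min (M i j) p := by
  have hp1 : p ≤ 1 := hpr.le.trans hr1
  have hle (i j : ℕ) (hij : i ≠ j) : M i j ≤ r := (hval i j hij).elim (·.trans hpr.le) (·.le)
  have hrow {a b : ℕ} (hab : a ≠ b) (hr : M a b = r) (l : ℕ) :
      min (M a l) p = min (M b l) p := by
    rcases eq_or_ne l a with rfl | hla
    · rw [hdiag, hsym, hr, min_eq_right hp1, min_eq_right hpr.le]
    rcases eq_or_ne l b with rfl | hlb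
    · rw [hdiag, hr, min_eq_right hp1, min_eq_right hpr.le]
    have hx (x : ℝ) : 0 ≤ x ^ 2 * r + 2 * x * (M a l - M b l) := by
      have hcard : ({a, b, l} : Finset ℕ).card = 3 :=
        Finset.card_eq_three.2 ⟨a, b, l, hab, hla.symm, hlb.symm, rfl⟩
      have h := hquad {a, b, l} r (by omega) (fun i _ j _ => hle i j)
        (fun i => if i = a then 1 else if i = b then -1 else x)
      rw [Finset.sum_insert (by simp [hab, hla.symm]), Finset.sum_pair hlb.symm] at h
      simp only [Finset.sum_insert (show a ∉ ({b, l} : Finset ℕ) by simp [hab, hla.symm]),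
        Finset.sum_pair hlb.symm, hab, hab.symm, hla, hla.symm, hlb, hlb.symm, if_true, if_false,
        hsym l a, hsym l b, hsym b a, hr] at h
      linarith
    have hr0 : 0 < r := hp0.trans_lt hpr
    have h := hx (-(M a l - M b l) / r)
    have e : (-(M a l - M b l) / r) ^ 2 * r + 2 * (-(M a l - M b l) / r) * (M a l - M b l)
        = -((M a l - M b l) ^ 2 / r) := by
      field_simp
      ring
    rw [e, neg_nonneg, div_le_iff₀ hr0, zero_mul] at h
    rw [sub_eq_zero.1 (pow_eq_zero_iff two_ne_zero |>.1 (le_antisymm h (sq_nonneg _)))]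
  induction hN : s.card generalizing s c with
  | zero => simp [Finset.card_eq_zero.1 hN]
  | succ N ih =>
    by_cases hex : ∃ a ∈ s, ∃ b ∈ s, a ≠ b ∧ M a b = r
    · obtain ⟨a, ha, b, hb, hab, hr⟩ := hex
      have h := ih (s.erase b) (Function.update c a (c a + c b))
        (by rw [Finset.card_erase_of_mem hb, hN]; rfl)
      convert h using 1
      simp only [mul_assoc, ← Finset.mul_sum]
      rw [sum_mul_eq_sum_erase ha hb hab]
      · refine Finset.sum_congr rfl fun i _ => ?_
        rw [sum_mul_eq_sum_erase ha hb hab]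
        rw [hsym i a, hsym i b]
        exact hrow hab hr i
      · exact Finset.sum_congr rfl fun j _ => by rw [hrow hab hr j]
    · have hlep : ∀ i ∈ s, ∀ j ∈ s, i ≠ j → M i j ≤ p := fun i hi j hj hij =>
        (hval i j hij).resolve_right fun h => hex ⟨i, hi, j, hj, hij, h⟩
      rcases Nat.eq_zero_or_pos N with rfl | hN0
      · obtain ⟨a, rfl⟩ := Finset.card_eq_one.1 hN
        simp only [Finset.sum_singleton, hdiag, min_eq_right hp1]
        exact mul_nonneg (mul_self_nonneg _) hp0
      · refine (hquad s p (by omega) hlep c).trans_eq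
          (Finset.sum_congr rfl fun i hi => Finset.sum_congr rfl fun j hj => ?_)
        split_ifs with hij
        · rw [hij, hdiag, min_eq_right hp1]
        · rw [min_eq_left (hlep i hi j hj hij)]

lemma ae_offDiag_mem {L : Measure Mat} [IsProbabilityMeasure L]
    (hexch : ∀ σ : ℕ → ℕ, Function.Injective σ → L.map (relabel σ) = L)
    {V : Set ℝ} (h : ∀ᵐ X ∂L, X 0 1 ∈ V) :
    ∀ᵐ X ∂L, ∀ i j, i ≠ j → X i j ∈ V := by
  simp only [ae_all_iff]
  intro i j hij
  obtain ⟨ρ, hρ⟩ := Equiv.Perm.exists_extending_pair (![0, 1] : Fin 2 → ℕ) ![i, j]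
    (by simp [Function.Injective]) (by simp [Function.Injective, hij, hij.symm])
  have h' := h
  rw [← hexch ρ ρ.injective] at h'
  have := ae_of_ae_map (measurable_relabel ρ).aemeasurable h'
  simpa [relabel, show ρ 0 = i from hρ 0, show ρ 1 = j from hρ 1] using this

lemma FiniteValueCondition.strictMonoOn {Ω : Type*} [MeasurableSpace Ω] {P : Measure Ω}
    {R : Ω → Mat} {k : ℕ} {q m : ℕ → ℝ} (h : FiniteValueCondition P R k q m) :
    StrictMonoOn q (Set.Icc 1 k) :=
  strictMonoOn_of_lt_succ Set.ordConnected_Icc fun a _ ha ha' =>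
    h.2.1 a ha.1 (Nat.lt_of_succ_le ha'.2)

lemma FiniteValueCondition.ae_mem {Ω : Type*} [MeasurableSpace Ω] {P : Measure Ω}
    [IsProbabilityMeasure P] {R : Ω → Mat} (hR : Measurable R) {k : ℕ} {q m : ℕ → ℝ}
    (h : FiniteValueCondition P R k q m) : ∀ᵐ ω ∂P, R ω 0 1 ∈ q '' Set.Icc 1 k := by
  obtain ⟨-, -, -, -, hm1, hmk, hm, hP⟩ := id h
  have hmeas (l : ℕ) : MeasurableSet {ω | R ω 0 1 = q l} :=
    measurableSet_eq_fun (by fun_prop) measurable_const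
  have h1 : P (⋃ l ∈ Finset.Ico 1 (k + 1), {ω | R ω 0 1 = q l}) = 1 := by
    rw [measure_biUnion_finset ?_ fun l _ => hmeas l]
    · rw [Finset.sum_congr rfl fun l hl => hP l (Finset.mem_Ico.1 hl).1
        (Nat.lt_succ_iff.1 (Finset.mem_Ico.1 hl).2), ← ENNReal.ofReal_sum_of_nonneg,
        Finset.sum_Ico_sub m (by omega), hm1, hmk]
      · simp
      · intro l hl
        rw [Finset.mem_Ico] at hl
        linarith [hm l hl.1 (by omega)]
    · intro l hl l' hl' hne
      simp only [Finset.coe_Ico, Set.mem_Ico] at hl hl'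
      refine Set.disjoint_left.2 fun ω (h1 : R ω 0 1 = q l) (h2 : R ω 0 1 = q l') => hne ?_
      exact h.strictMonoOn.injOn ⟨hl.1, by omega⟩ ⟨hl'.1, by omega⟩ (h1.symm.trans h2)
  have h2 := (prob_compl_eq_zero_iff
    (Finset.measurableSet_biUnion (Finset.Ico 1 (k + 1)) fun l _ => hmeas l)).2 h1
  filter_upwards [measure_eq_zero_iff_ae_notMem.1 h2] with ω hω
  simp only [Set.mem_compl_iff, not_not, Set.mem_iUnion, Finset.mem_Ico] at hω
  obtain ⟨l, hl, hω⟩ := hω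
  exact ⟨l, ⟨hl.1, by omega⟩, hω.symm⟩

lemma SatisfiesGGI.min_const {Ω : Type*} [MeasurableSpace Ω] {P : Measure Ω} {R : Ω → Mat}
    (h : SatisfiesGGI P R) (p : ℝ) : SatisfiesGGI P (fun ω i j => min (R ω i j) p) := by
  intro n hn f hf ⟨C, hC⟩ ψ hψ ⟨C', hC'⟩
  exact h n hn (fun x => f fun i => min (x i) p) (hf.comp (by fun_prop)) ⟨C, fun x => hC _⟩
    (fun x => ψ (min x p)) (hψ.comp (by fun_prop)) ⟨C', fun x => hC' _⟩

lemma ae_truncation_quadratic_nonneg {Ω : Type*} [MeasurableSpace Ω] {P : Measure Ω}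
    [IsProbabilityMeasure P] {R : Ω → Mat} {k : ℕ} (hk : 2 ≤ k) {q m : ℕ → ℝ}
    (hGdF : IsGramDeFinetti P R) (hGGI : SatisfiesGGI P R)
    (hFV : FiniteValueCondition P R k q m) :
    ∀ᵐ ω ∂P, ∀ (n : ℕ) (c : Fin n → ℝ),
      0 ≤ ∑ i : Fin n, ∑ j : Fin n, c i * c j * min (R ω i j) (q (k - 1)) := by
  obtain ⟨hR, -, hsymP, hpsdP, hexchP⟩ := hGdF
  have hmono := hFV.strictMonoOn
  have hmem := hFV.ae_mem hR
  obtain ⟨hdiagP, -, hq1, hqk, -⟩ := hFV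
  have : IsProbabilityMeasure (P.map R) := Measure.isProbabilityMeasure_map hR.aemeasurable
  have hexch : ∀ σ : ℕ → ℕ, Function.Injective σ → (P.map R).map (relabel σ) = P.map R :=
    map_relabel_eq hR hexchP
  have hsym : ∀ᵐ X ∂(P.map R), ∀ i j, X i j = X j i := by
    refine (ae_map_iff hR.aemeasurable ?_).2 hsymP
    simp only [Set.ofPred_forall]
    exact MeasurableSet.iInter fun i => MeasurableSet.iInter fun j =>
      measurableSet_eq_fun (by fun_prop) (by fun_prop)
  have hdiag : ∀ᵐ X ∂(P.map R), ∀ i, X i i = 1 := by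
    refine (ae_map_iff hR.aemeasurable ?_).2 hdiagP
    simp only [Set.ofPred_forall]
    exact MeasurableSet.iInter fun i => measurableSet_eq_fun (by fun_prop) measurable_const
  have hpsd : ∀ᵐ X ∂(P.map R), ∀ (n : ℕ) (c : Fin n → ℝ),
      0 ≤ ∑ i : Fin n, ∑ j : Fin n, c i * c j * X i j := by
    refine (ae_map_iff hR.aemeasurable (IsClosed.measurableSet ?_)).2 hpsdP
    simp only [Set.ofPred_forall]
    exact isClosed_iInter fun n => isClosed_iInter fun c =>
      isClosed_le continuous_const (by fun_prop)
  have hVc : (q '' Set.Icc 1 k).Countable := (Set.to_countable _).image q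
  have hval := ae_offDiag_mem hexch ((ae_map_iff hR.aemeasurable
    (measurable_pi_apply 1 |>.comp (measurable_pi_apply 0) <| hVc.measurableSet)).2 hmem)
  have hquad := ae_quadratic_nonneg (hsym := hsym) (satisfiesGGI_map hR hGGI) hexch hpsd hdiag
    hVc hval
  filter_upwards [hsymP, hdiagP, ae_of_ae_map hR.aemeasurable hval,
    ae_of_ae_map hR.aemeasurable hquad] with ω hs hd hv hq n c
  have hmem1 : k - 1 ∈ Set.Icc 1 k := ⟨by omega, by omega⟩
  have h := truncation_quadratic_nonneg hs hd
    (hq1.trans (hmono.monotoneOn ⟨le_rfl, by omega⟩ hmem1 (by omega)))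
    (hmono hmem1 ⟨by omega, le_rfl⟩ (by omega)) hqk
    (fun i j hij => ?_) hq (Finset.range n) (fun a => if h : a < n then c ⟨a, h⟩ else 0)
  · simpa [Finset.sum_range] using h
  · obtain ⟨l, hl, hl'⟩ := hv i j hij
    rw [← hl']
    rcases (show l ≤ k - 1 ∨ l = k by have := hl.2; omega) with h | rfl
    · exact Or.inl (hmono.monotoneOn hl hmem1 h)
    · exact Or.inr rfl

/-- The truncated matrix `R⁻_{l,l'} = min (R_{l,l'}, q_{k-1})` of a Gram–de
Finetti matrix satisfying the Ghirlanda–Guerra identities and the finite-value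
condition (with `k ≥ 2`) is symmetric, weakly exchangeable, a.s. has all finite
submatrices positive semidefinite, satisfies the Ghirlanda–Guerra identities,
and takes the value `q_{k-1}` with probability `1 - m_{k-1}` and the value `q_l`
with probability `m_{l+1} - m_l` for `1 ≤ l ≤ k-2`. -/
theorem truncation_induction_step {Ω : Type*} [MeasurableSpace Ω] (P : Measure Ω)
    [IsProbabilityMeasure P] (R : Ω → Mat) (k : ℕ) (hk : 2 ≤ k) (q m : ℕ → ℝ)
    (hGdF : IsGramDeFinetti P R) (hGGI : SatisfiesGGI P R)
    (hFV : FiniteValueCondition P R k q m)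
    (Rm : Ω → Mat) (hRm : Rm = fun ω i j => min (R ω i j) (q (k - 1))) :
    (∀ᵐ ω ∂P, ∀ i j, Rm ω i j = Rm ω j i) ∧
    (∀ (n : ℕ) (ρ : Equiv.Perm (Fin n)),
      Measure.map (fun ω => fun i j : Fin n => Rm ω (ρ i) (ρ j)) P
        = Measure.map (fun ω => fun i j : Fin n => Rm ω i j) P) ∧
    (∀ᵐ ω ∂P, ∀ (n : ℕ) (c : Fin n → ℝ),
      0 ≤ ∑ i : Fin n, ∑ j : Fin n, c i * c j * Rm ω i j) ∧
    SatisfiesGGI P Rm ∧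
    (P {ω | Rm ω 0 1 = q (k - 1)} = ENNReal.ofReal (1 - m (k - 1))) ∧
    (∀ l, 1 ≤ l → l ≤ k - 2 →
      P {ω | Rm ω 0 1 = q l} = ENNReal.ofReal (m (l + 1) - m l)) := by
  subst hRm
  refine ⟨?_, ?_, ae_truncation_quadratic_nonneg hk hGdF hGGI hFV, hGGI.min_const _, ?_, ?_⟩
  · filter_upwards [hGdF.2.2.1] with ω hω i j
    rw [hω]
  · intro n ρ
    have hR := hGdF.1
    have hg : Measurable (fun (X : Fin n → Fin n → ℝ) (i j : Fin n) =>
        min (X i j) (q (k - 1))) := by fun_prop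
    have h := congrArg (Measure.map fun (X : Fin n → Fin n → ℝ) (i j : Fin n) =>
        min (X i j) (q (k - 1))) (hGdF.2.2.2.2 n ρ)
    rwa [Measure.map_map hg (by fun_prop), Measure.map_map hg (by fun_prop)] at h
  · have hR := hGdF.1
    have hmono := hFV.strictMonoOn
    have hmem := hFV.ae_mem hR
    obtain ⟨-, -, -, -, -, hmk, hm, hP⟩ := hFV
    have hmem1 : k - 1 ∈ Set.Icc 1 k := ⟨by omega, by omega⟩
    have hlt : q (k - 1) < q k := hmono hmem1 ⟨by omega, le_rfl⟩ (by omega)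
    have e : {ω | min (R ω 0 1) (q (k - 1)) = q (k - 1)}
        =ᵐ[P] ({ω | R ω 0 1 = q (k - 1)} ∪ {ω | R ω 0 1 = q k} : Set Ω) := by
      refine Filter.eventuallyEq_set.2 ?_
      filter_upwards [hmem] with ω ⟨l, hl, hω⟩
      simp only [Set.mem_ofPred_eq, Set.mem_union, min_eq_right_iff, ← hω,
        hmono.injOn.eq_iff hl hmem1, hmono.injOn.eq_iff hl ⟨(by omega : 1 ≤ k), le_rfl⟩,
        hmono.le_iff_le hmem1 hl]
      have := hl.2
      omega
    have h1 := hP (k - 1) (by omega) (by omega)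
    have h2 := hP k (by omega) le_rfl
    have h3 := hm (k - 1) (by omega) (by omega)
    have h4 := hm k (by omega) le_rfl
    rw [show k - 1 + 1 = k by omega] at h1 h3
    rw [measure_congr e, measure_union ?_ (measurableSet_eq_fun (by fun_prop) measurable_const),
      h1, h2, ← ENNReal.ofReal_add (by linarith) (by linarith), hmk]
    · congr 1
      ring
    · exact Set.disjoint_left.2 fun ω (h1 : R ω 0 1 = _) (h2 : R ω 0 1 = _) =>
        hlt.ne (h1.symm.trans h2)
  · intro l hl1 hl2
    have hlt : q l < q (k - 1) :=
      hFV.strictMonoOn ⟨hl1, by omega⟩ ⟨by omega, by omega⟩ (by omega)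
    rw [← hFV.2.2.2.2.2.2.2 l hl1 (by omega)]
    congr 1
    ext ω
    simp only [Set.mem_ofPred_eq, min_eq_iff]
    refine ⟨fun h => h.elim (·.1) fun h => absurd h.1 hlt.ne', fun h => Or.inl ⟨h, ?_⟩⟩
    rw [h]
    exact hlt.le

end
end

section
/- lim_{t → +∞} P( w_1 e^{−t g_1} > w_2 e^{−t g_2} > ⋯ > w_n e^{−t g_n} ) = 1/n!. -/
open MeasureTheory ProbabilityTheory Filter

noncomputable section

/-- Coordinates of a sample from a product of copies of an atomless law are a.s. distinct. -/
lemma ae_injective_pi {ι α : Type*} [Fintype ι] [MeasurableSpace α] [MeasurableEq α]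
    (μ : Measure α) [IsProbabilityMeasure μ] [NullSingletonClass μ] :
    ∀ᵐ g ∂(Measure.pi fun _ : ι => μ), Function.Injective g := by
  have key : ∀ i j : ι, i ≠ j → ∀ᵐ g ∂(Measure.pi fun _ : ι => μ), g i ≠ g j := by
    intro i j hij
    have hind := (iIndepFun_pi (μ := fun _ : ι => μ) (X := fun _ x => x)
      fun _ => aemeasurable_id).indepFun hij
    have hmap := hind.map_prod_eq_prod_map_map
      (measurable_pi_apply i).aemeasurable (measurable_pi_apply j).aemeasurable
    have heval : ∀ k : ι, (Measure.pi fun _ : ι => μ).map (fun g => g k) = μ :=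
      fun k => (measurePreserving_eval (fun _ : ι => μ) k).map_eq
    rw [heval i, heval j] at hmap
    have hdiag : ∀ᵐ p ∂(μ.prod μ), p.1 ≠ p.2 := by
      rw [ae_iff]
      simp only [ne_eq, not_not]
      change (μ.prod μ) (Set.diagonal α) = 0
      rw [Measure.measure_prod_null measurableSet_diagonal]
      refine ae_of_all _ fun x => ?_
      simp [Set.preimage]
    rw [← hmap] at hdiag
    exact ae_of_ae_map ((measurable_pi_apply i).prodMk (measurable_pi_apply j)).aemeasurable hdiag
  have hall : ∀ᵐ g ∂(Measure.pi fun _ : ι => μ), ∀ i j : ι, i ≠ j → g i ≠ g j := by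
    simp only [ae_all_iff]
    exact key
  filter_upwards [hall] with g hg i j h
  by_contra hij
  exact hg i j hij h

lemma measurableSet_strictMono {ι : Type*} [Countable ι] [Preorder ι] :
    MeasurableSet {g : ι → ℝ | StrictMono g} := by
  have : {g : ι → ℝ | StrictMono g} = ⋂ i, ⋂ j, ⋂ (_ : i < j), {g | g i < g j} := by
    ext g
    simp [StrictMono]
  rw [this]
  exact MeasurableSet.iInter fun i => MeasurableSet.iInter fun j => MeasurableSet.iInter fun _ =>
    measurableSet_lt (measurable_pi_apply i) (measurable_pi_apply j)

/-- An i.i.d. sample of size `n` from an atomless law on `ℝ` is increasing with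
probability `1 / n!`. -/
lemma measureReal_pi_strictMono (n : ℕ) (μ : Measure ℝ) [IsProbabilityMeasure μ]
    [NullSingletonClass μ] :
    (Measure.pi fun _ : Fin n => μ).real {g | StrictMono g} = 1 / (n.factorial : ℝ) := by
  set P := Measure.pi fun _ : Fin n => μ
  let A : Equiv.Perm (Fin n) → Set (Fin n → ℝ) := fun σ => {g | StrictMono (g ∘ σ)}
  have hpres : ∀ σ : Equiv.Perm (Fin n), MeasurePreserving (fun g : Fin n → ℝ => g ∘ σ) P P := by
    intro σ
    have h := measurePreserving_piCongrLeft (fun _ : Fin n => μ) σ.symm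
    convert h using 1
    ext g i
    obtain ⟨k, rfl⟩ := σ.symm.surjective i
    simp [MeasurableEquiv.coe_piCongrLeft, Equiv.piCongrLeft_apply_apply]
  have hA : ∀ σ, MeasurableSet (A σ) := fun σ =>
    (hpres σ).measurable measurableSet_strictMono
  have hmeas : ∀ σ, P.real (A σ) = P.real {g | StrictMono g} := fun σ =>
    (hpres σ).measureReal_preimage measurableSet_strictMono.nullMeasurableSet
  have hdisj : Pairwise fun σ τ => Disjoint (A σ) (A τ) := by
    intro σ τ hne
    refine Set.disjoint_left.2 fun g hσ hτ => hne ?_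
    have hg : Function.Injective g := by
      have := hσ.injective.comp σ.symm.injective
      simpa [Function.comp_assoc] using this
    ext1 i
    exact hg (congrFun (Tuple.unique_monotone hσ.monotone hτ.monotone) i)
  have hunion : P.real (⋃ σ, A σ) = 1 := by
    rw [measureReal_def, ENNReal.toReal_eq_one_iff, 
      ← mem_ae_iff_prob_eq_one (MeasurableSet.iUnion hA)]
    filter_upwards [ae_injective_pi (ι := Fin n) μ] with g hg
    exact Set.mem_iUnion.2 ⟨Tuple.sort g,
      (Tuple.monotone_sort g).strictMono_of_injective (hg.comp (Tuple.sort g).injective)⟩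
  rw [measureReal_iUnion_fintype hdisj hA] at hunion
  simp only [hmeas, Finset.sum_const, Finset.card_univ, Fintype.card_perm, Fintype.card_fin,
    nsmul_eq_mul] at hunion
  rw [eq_div_iff (by positivity), mul_comm]
  exact hunion

/-- For `x ≠ y`, the order of `b * e^{-ty}` and `a * e^{-tx}` is eventually that of `x` and `y`. -/
lemma eventually_mul_exp_lt_iff {a b x y : ℝ} (ha : 0 < a) (hb : 0 < b) (hxy : x ≠ y) :
    ∀ᶠ t : ℝ in atTop, b * Real.exp (-t * y) < a * Real.exp (-t * x) ↔ x < y := by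
  have main : ∀ {a b x y : ℝ}, 0 < a → 0 < b → x < y →
      ∀ᶠ t : ℝ in atTop, b * Real.exp (-t * y) < a * Real.exp (-t * x) := by
    intro a b x y ha hb hxy
    filter_upwards [eventually_gt_atTop ((Real.log b - Real.log a) / (y - x))] with t ht
    rw [div_lt_iff₀ (sub_pos.2 hxy)] at ht
    rw [← Real.exp_log ha, ← Real.exp_log hb, ← Real.exp_add, ← Real.exp_add, Real.exp_lt_exp]
    linarith
  rcases hxy.lt_or_gt with h | h
  · filter_upwards [main ha hb h] with t ht
    exact iff_of_true ht h
  · filter_upwards [main hb ha h] with t ht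
    exact iff_of_false ht.not_gt h.not_gt

/-- For fixed positive weights `w_1, …, w_n` and i.i.d. standard Gaussian
`g_1, …, g_n`, the probability that `w_1 e^{-t g_1} > w_2 e^{-t g_2} > ⋯ >
w_n e^{-t g_n}` tends to `1/n!` as `t → +∞`. -/
theorem gaussian_tilt_order_prob_tendsto (n : ℕ) (hn : 1 ≤ n)
    (w : Fin n → ℝ) (hw : ∀ i, 0 < w i) :
    Tendsto (fun t : ℝ =>
        ((Measure.pi fun _ : Fin n => gaussianReal 0 1)
          {g | ∀ i j : Fin n, i < j →
            w j * Real.exp (-t * g j) < w i * Real.exp (-t * g i)}).toReal)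
      atTop (nhds (1 / (n.factorial : ℝ))) := by
  have : NullSingletonClass (gaussianReal 0 1) := nullSingletonClass_gaussianReal one_ne_zero
  rw [← measureReal_pi_strictMono n (gaussianReal 0 1)]
  refine (ENNReal.tendsto_toReal (measure_ne_top _ _)).comp ?_
  refine tendsto_measure_of_ae_tendsto_indicator_of_isFiniteMeasure atTop
    measurableSet_strictMono (fun t => ?_) ?_
  · simp only [Set.ofPred_forall]
    exact MeasurableSet.iInter fun i => MeasurableSet.iInter fun j =>
      MeasurableSet.iInter fun _ => measurableSet_lt (by fun_prop) (by fun_prop)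
  · filter_upwards [ae_injective_pi (ι := Fin n) (gaussianReal 0 1)] with g hg
    have hev : ∀ᶠ t : ℝ in atTop, ∀ i j : Fin n, i < j →
        (w j * Real.exp (-t * g j) < w i * Real.exp (-t * g i) ↔ g i < g j) := by
      simp only [eventually_all]
      exact fun i j hij => eventually_mul_exp_lt_iff (hw i) (hw j) (hg.ne hij.ne)
    filter_upwards [hev] with t ht
    exact forall₂_congr fun i j => forall_congr' (ht i j)

end
end
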